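/- Assume B is primitive, infinite, 1 ∉ B, and X_η = X_B, i.e. the B-free subshift coincides with the B-admissible subshift. Then (X_η, S) has the Myhill property: every pre-injective cellular automaton on (X_η, S) is surjective. -/

import Mathlib

open Filter Set

noncomputable section

/-- The shift by `t`: `(shiftPow t x) n = x (n + t)`, i.e. `S^t`. -/
def shiftPow (t : ℤ) (x : ℤ → Bool) : ℤ → Bool := fun n => x (n + t)

/-- The left shift `S`, `(S x) n = x (n + 1)`. -/
def shift : (ℤ → Bool) → (ℤ → Bool) := shiftPow 1

/-- The support of a `0-1`-sequence. -/
def supp (x : ℤ → Bool) : Set ℤ := {n | x n = true}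

/-- The all-zero sequence `0^ℤ`. -/
def zeroSeq : ℤ → Bool := fun _ => false

/-- The all-one sequence `1^ℤ`. -/
def oneSeq : ℤ → Bool := fun _ => true

/-- The sequence `u = 0^{-ℕ} 1 0^{ℕ}` with a single `1` at position `0`. -/
def uSeq : ℤ → Bool := fun n => if n = 0 then true else false

/-- The set `F_B ⊆ ℤ` of `B`-free integers. -/
def BFreeSet (B : Set ℕ) : Set ℤ := {n | ∀ b ∈ B, ¬ ((b : ℤ) ∣ n)}

open Classical in
/-- `η`, the indicator function of the `B`-free integers. -/
noncomputable def eta (B : Set ℕ) : ℤ → Bool := fun n => if n ∈ BFreeSet B then true else false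

/-- The `B`-free subshift `X_η`: the orbit closure of `η` under the shift. -/
def Xeta (B : Set ℕ) : Set (ℤ → Bool) := closure {x | ∃ t : ℤ, x = shiftPow t (eta B)}

/-- A set `A ⊆ ℤ` is `B`-admissible if for every `b ∈ B` some residue class
mod `b` is disjoint from `A`. -/
def IsBAdmissible (B : Set ℕ) (A : Set ℤ) : Prop :=
  ∀ b ∈ B, ∃ r : ℤ, ∀ a ∈ A, ¬ ((b : ℤ) ∣ (a - r))

/-- The `B`-admissible subshift `X_B`. -/
def XB (B : Set ℕ) : Set (ℤ → Bool) := {x | IsBAdmissible B (supp x)}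

/-- `B` is primitive: no element divides a different element. -/
def Primitive (B : Set ℕ) : Prop := ∀ a ∈ B, ∀ b ∈ B, a ∣ b → a = b

/-- `B` is an Erdős set: infinite, `1 ∉ B` (elements positive), primitive, pairwise
coprime and thin. -/
def IsErdos (B : Set ℕ) : Prop :=
  B.Infinite ∧ (∀ b ∈ B, 2 ≤ b) ∧ Primitive B ∧
    (∀ a ∈ B, ∀ b ∈ B, a ≠ b → Nat.Coprime a b) ∧
    Summable (fun b : B => (1 : ℝ) / (b : ℝ))

/-- A cellular automaton on `X`: a continuous self-map of `X` commuting with the shift. -/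
def IsCA (X : Set (ℤ → Bool)) (τ : (ℤ → Bool) → (ℤ → Bool)) : Prop :=
  Set.MapsTo τ X X ∧ ContinuousOn τ X ∧ ∀ x ∈ X, τ (shift x) = shift (τ x)

/-- Pre-injectivity of a CA on `X`. -/
def PreInjective (X : Set (ℤ → Bool)) (τ : (ℤ → Bool) → (ℤ → Bool)) : Prop :=
  ∀ x ∈ X, ∀ y ∈ X, τ x = τ y → {n : ℤ | x n ≠ y n}.Finite → x = y

/-- `X` is hereditary. -/
def Hereditary (X : Set (ℤ → Bool)) : Prop :=
  ∀ x ∈ X, ∀ y : ℤ → Bool, (∀ n, y n ≤ x n) → y ∈ X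

/-- The hereditary closure `X̃` of a set `X`. -/
def heredClosure (X : Set (ℤ → Bool)) : Set (ℤ → Bool) :=
  {y | ∃ x ∈ X, ∀ n, y n ≤ x n}

/-- `X` is a subshift: nonempty, closed and shift-invariant. -/
def IsSubshift (X : Set (ℤ → Bool)) : Prop :=
  X.Nonempty ∧ IsClosed X ∧ shift '' X = X

/-- `τ` is given by a (sliding block) code of radius `ℓ` on `X`. -/
def HasRadius (X : Set (ℤ → Bool)) (τ : (ℤ → Bool) → (ℤ → Bool)) (ℓ : ℕ) : Prop :=
  ∀ x ∈ X, ∀ y ∈ X, ∀ n : ℤ,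
    (∀ i : ℤ, n - ℓ ≤ i → i ≤ n + ℓ → x i = y i) → τ x n = τ y n

open Classical in
/-- `A ⊆ ℤ` has logarithmic density `d`. -/
noncomputable def HasLogDensity (A : Set ℤ) (d : ℝ) : Prop :=
  Tendsto (fun N : ℕ =>
      (Real.log N)⁻¹ * ∑ n ∈ Finset.Icc 1 N, (if (n : ℤ) ∈ A then (1 : ℝ) / (n : ℝ) else 0))
    atTop (nhds d)

/-- `B` is taut: removing any `b ∈ B` strictly increases the logarithmic density of the
`B`-free integers. -/
def IsTaut (B : Set ℕ) : Prop :=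
  ∀ b ∈ B, ∀ d d' : ℝ,
    HasLogDensity (BFreeSet B) d → HasLogDensity (BFreeSet (B \ {b})) d' → d < d'

/-- `x` and `y` are proximal: along some sequence `r k → ∞`, the shifted sequences
`S^{r k} x` and `S^{r k} y` agree on arbitrarily large central windows, i.e.
`d(S^{r k} x, S^{r k} y) → 0` in the product topology. -/
def ProximalPair (x y : ℤ → Bool) : Prop :=
  ∃ r : ℕ → ℤ, Tendsto r atTop atTop ∧
    ∀ m : ℕ, ∀ᶠ k in atTop, ∀ n : ℤ, |n| ≤ (m : ℤ) →
      shiftPow (r k) x n = shiftPow (r k) y n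

/-- A subshift is proximal if every pair of its points is proximal. -/
def IsProximalSubshift (X : Set (ℤ → Bool)) : Prop :=
  ∀ x ∈ X, ∀ y ∈ X, ProximalPair x y

end

open Classical in
/-- The indicator sequence of a set of integers. -/
noncomputable def indSeq (A : Set ℤ) : ℤ → Bool := fun n => decide (n ∈ A)

lemma indSeq_eq_true {A : Set ℤ} {n : ℤ} : indSeq A n = true ↔ n ∈ A := by
  simp [indSeq]

lemma indSeq_mem_XB {B : Set ℕ} {A : Set ℤ} : indSeq A ∈ XB B ↔ IsBAdmissible B A := by
  have : supp (indSeq A) = A := by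
    ext n
    exact indSeq_eq_true
  rw [XB, mem_ofPred_eq, this]

lemma IsBAdmissible.mono {B : Set ℕ} {A A' : Set ℤ} (h : IsBAdmissible B A) (hA : A' ⊆ A) :
    IsBAdmissible B A' := fun b hb => by
  obtain ⟨r, hr⟩ := h b hb
  exact ⟨r, fun a ha => hr a (hA ha)⟩

lemma shiftPow_mem_XB {B : Set ℕ} {x : ℤ → Bool} (hx : x ∈ XB B) (t : ℤ) :
    shiftPow t x ∈ XB B := fun b hb => by
  obtain ⟨r, hr⟩ := hx b hb
  refine ⟨r - t, fun a ha hd => hr (a + t) ha ?_⟩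
  convert hd using 1
  ring

/-- A finite set with fewer than `b` elements misses a residue class mod `b`. -/
lemma exists_missed_class (F : Finset ℤ) {b : ℕ} (hb : F.card < b) :
    ∃ r : ℤ, ∀ a ∈ F, ¬ ((b : ℤ) ∣ a - r) := by
  have hb0 : 0 < b := by omega
  have hlt : (F.image (fun a => a % (b : ℤ))).card < (Finset.Ico (0 : ℤ) b).card := by
    refine lt_of_le_of_lt Finset.card_image_le ?_
    simpa using hb
  obtain ⟨r, hr, hrF⟩ := Finset.exists_mem_notMem_of_card_lt_card hlt
  refine ⟨r, fun a ha hd => hrF (Finset.mem_image.2 ⟨a, ha, ?_⟩)⟩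
  rw [Finset.mem_Ico] at hr
  have h2 : a % (b : ℤ) = r % (b : ℤ) := Int.emod_eq_emod_iff_emod_sub_eq_zero.2
    (Int.emod_eq_zero_of_dvd hd)
  rw [h2, Int.emod_eq_of_lt hr.1 hr.2]

/-- A finite admissible set can be translated into the `B`-free integers when `X_η = X_B`. -/
lemma exists_translate_free {B : Set ℕ} (heq : Xeta B = XB B) (F : Finset ℤ)
    (hF : IsBAdmissible B F) : ∃ t : ℤ, ∀ n ∈ F, ∀ b ∈ B, ¬ ((b : ℤ) ∣ n + t) := by
  have hmem : indSeq (F : Set ℤ) ∈ Xeta B := heq ▸ indSeq_mem_XB.2 hF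
  have hopen : IsOpen {x : ℤ → Bool | ∀ n ∈ F, x n = true} := by
    have : {x : ℤ → Bool | ∀ n ∈ F, x n = true} = (F : Set ℤ).pi (fun _ => {true}) := by
      ext x
      simp [Set.mem_pi]
    rw [this]
    exact isOpen_set_pi F.finite_toSet (fun _ _ => isOpen_discrete _)
  obtain ⟨x, hx, t, rfl⟩ := mem_closure_iff.1 hmem _ hopen
    (fun n hn => indSeq_eq_true.2 hn)
  refine ⟨t, fun n hn b hb => ?_⟩
  have := hx n hn
  simp only [shiftPow, eta, Bool.if_false_right, Bool.and_true, decide_eq_true_eq] at this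
  exact this b hb

/-- Dirichlet's theorem applied to a class mod `L`. -/
lemma exists_modEq_not_dvd {L n₀ : ℕ} (hL : 0 < L) (c : ℕ) :
    ∃ n : ℕ, n ≡ n₀ [MOD L] ∧ ∀ b, 0 < b → b < c → b ∣ n → b ∣ L := by
  obtain ⟨D, n', L', hDpos, hcop, hn', hL'⟩ : ∃ D n' L' : ℕ, 0 < D ∧ Nat.Coprime n' L' ∧
      n₀ = n' * D ∧ L = L' * D :=
    ⟨_, _, _, Nat.gcd_pos_of_pos_right n₀ hL, Nat.coprime_div_gcd_div_gcd
      (Nat.gcd_pos_of_pos_right n₀ hL), (Nat.div_mul_cancel (Nat.gcd_dvd_left n₀ L)).symm,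
      (Nat.div_mul_cancel (Nat.gcd_dvd_right n₀ L)).symm⟩
  have : NeZero L' := ⟨by rintro rfl; simp at hL'; omega⟩
  obtain ⟨p, hpc, hp, hpe⟩ := Nat.forall_exists_prime_gt_and_eq_mod
    ((ZMod.isUnit_iff_coprime n' L').2 hcop) c
  refine ⟨p * D, ?_, fun b hb0 hbc hbd => ?_⟩
  · rw [hn', hL']
    exact Nat.ModEq.mul_right' D ((ZMod.natCast_eq_natCast_iff _ _ _).1 hpe)
  · have : Nat.Coprime b p := (hp.coprime_iff_not_dvd.2 fun h => by
      have := Nat.le_of_dvd hb0 h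
      omega).symm
    exact (this.dvd_of_dvd_mul_left hbd).trans ⟨L', by rw [hL', mul_comm]⟩

/-- If `X_η = X_B` for a primitive `B`, then `B` is pairwise coprime. -/
lemma coprime_of_eq_admissible {B : Set ℕ} (hBpos : ∀ b ∈ B, 2 ≤ b) (hBprim : Primitive B)
    (heq : Xeta B = XB B) : ∀ a ∈ B, ∀ b ∈ B, a ≠ b → Nat.Coprime a b := by
  classical
  have key : ¬ ∃ c, c ∈ B ∧ ∃ a ∈ B, a < c ∧ ¬ Nat.Coprime a c := by
    intro hex
    obtain ⟨hc, a, ha, hac, hncop⟩ := Nat.find_spec hex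
    have hmin := fun m => @Nat.find_min _ _ hex m
    set c := Nat.find hex
    clear_value c
    have hcop : ∀ b ∈ B, b < c → b ≠ a → Nat.Coprime b a := by
      intro b hb hbc hba
      by_contra hn
      rcases lt_or_gt_of_ne hba with h | h
      · exact hmin a hac ⟨ha, b, hb, h, hn⟩
      · exact hmin b hbc ⟨hb, a, ha, h, fun h' => hn h'.symm⟩
    have ha2 := hBpos a ha
    have hc2 := hBpos c hc
    obtain ⟨g, hg⟩ : ∃ g, g = Nat.gcd a c := ⟨_, rfl⟩
    obtain ⟨a', ha'⟩ : g ∣ a := hg ▸ Nat.gcd_dvd_left a c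
    obtain ⟨c', hc'⟩ : g ∣ c := hg ▸ Nat.gcd_dvd_right a c
    have hg0 : 0 < g := hg ▸ Nat.gcd_pos_of_pos_left _ (by omega)
    have hg2 : 2 ≤ g := by
      have : g ≠ 1 := fun h => hncop (by rw [Nat.Coprime, ← hg, h])
      omega
    have hac' : a' < c' := by
      rw [ha', hc'] at hac
      exact Nat.lt_of_mul_lt_mul_left hac
    have ha'0 : 0 < a' := by
      rcases Nat.eq_zero_or_pos a' with h | h
      · simp [h] at ha'; omega
      · exact h
    have ha'2 : 2 ≤ a' := by
      by_contra h
      have h1 : a' = 1 := by omega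
      have : a = g := by rw [ha', h1, mul_one]
      have := hBprim a ha c hc (this ▸ ⟨c', hc'⟩)
      omega
    have hpt : ∀ s t : ℕ, s ≡ t [MOD g] → ¬ a ∣ s →
        ∃ n : ℕ, n ≡ s [MOD a] ∧ n ≡ t [MOD c] ∧ ∀ b ∈ B, b < c → ¬ b ∣ n := by
      intro s t hst has
      obtain ⟨n₀, h1, h2⟩ := Nat.chineseRemainder' (hg ▸ hst : s ≡ t [MOD Nat.gcd a c])
      have hL : 0 < Nat.lcm a c := Nat.lcm_pos (by omega) (by omega)
      obtain ⟨n, hn, hnd⟩ := exists_modEq_not_dvd (n₀ := n₀) hL c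
      have hna : n ≡ s [MOD a] := (hn.of_dvd (Nat.dvd_lcm_left a c)).trans h1
      refine ⟨n, hna, (hn.of_dvd (Nat.dvd_lcm_right a c)).trans h2, ?_⟩
      intro b hb hbc hbn
      by_cases hba : b = a
      · subst hba
        exact has ((hna.dvd_iff (dvd_refl _)).1 hbn)
      · have hbac : b ∣ a * c :=
          (hnd b (by have := hBpos b hb; omega) hbc hbn).trans (Nat.lcm_dvd_mul a c)
        have := hBprim b hb c hc ((hcop b hb hbc hba).dvd_of_dvd_mul_left hbac)
        omega
    have hpt1 : ∀ p : ℕ × ℕ, ∃ n : ℕ, p ∈ Finset.range a' ×ˢ Finset.Ico 1 g →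
        n ≡ g * p.1 + p.2 [MOD a] ∧ ∀ b ∈ B, b < c → ¬ b ∣ n := by
      intro p
      by_cases hp : p ∈ Finset.range a' ×ˢ Finset.Ico 1 g
      · simp only [Finset.mem_product, Finset.mem_range, Finset.mem_Ico] at hp
        obtain ⟨n, h1, -, h3⟩ := hpt (g * p.1 + p.2) (g * p.1 + p.2) rfl (fun hd => by
          have : g ∣ g * p.1 + p.2 := (Dvd.intro a' ha'.symm).trans hd
          have := Nat.le_of_dvd (by omega) ((Nat.dvd_add_right (Dvd.intro _ rfl)).1 this)
          omega)
        exact ⟨n, fun _ => ⟨h1, h3⟩⟩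
      · exact ⟨0, fun h => absurd h hp⟩
    have hpt2 : ∀ j : ℕ, ∃ n : ℕ, n ≡ g * (1 + j % (a' - 1)) [MOD a] ∧ n ≡ g * j [MOD c] ∧
        ∀ b ∈ B, b < c → ¬ b ∣ n := by
      intro j
      refine hpt _ _ ?_ ?_
      · exact (Nat.modEq_zero_iff_dvd.2 (Dvd.intro _ rfl)).trans
          (Nat.modEq_zero_iff_dvd.2 (Dvd.intro _ rfl)).symm
      · intro hd
        rw [ha'] at hd
        have h1 := Nat.le_of_dvd (by omega) (Nat.dvd_of_mul_dvd_mul_left hg0 hd)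
        have h2 := Nat.mod_lt j (show 0 < a' - 1 by omega)
        omega
    choose f hf using hpt1
    choose h hh1 hh2 hh3 using hpt2
    set N : Finset ℕ := (Finset.range a' ×ˢ Finset.Ico 1 g).image f ∪
      (Finset.range c').image h with hN
    have hNfree : ∀ n ∈ N, ∀ b ∈ B, b < c → ¬ b ∣ n := by
      intro n hn
      rw [hN, Finset.mem_union, Finset.mem_image, Finset.mem_image] at hn
      rcases hn with ⟨p, hp, rfl⟩ | ⟨j, -, rfl⟩
      · exact (hf p hp).2
      · exact hh3 j
    have hNcard : N.card < c := by
      have h1 : N.card ≤ a' * (g - 1) + c' := by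
        refine (Finset.card_union_le _ _).trans (add_le_add ?_ ?_)
        · refine Finset.card_image_le.trans ?_
          simp
        · exact Finset.card_image_le.trans (by simp)
      obtain ⟨k, rfl⟩ : ∃ k, g = k + 1 := ⟨g - 1, by omega⟩
      have h3 : a' * k < c' * k := Nat.mul_lt_mul_of_pos_right hac' (by omega)
      simp only [Nat.add_sub_cancel] at h1
      rw [hc']
      linarith [mul_comm c' k, add_mul k 1 c']
    have hadm : IsBAdmissible B ((N.image (fun n : ℕ => (n : ℤ)) : Finset ℤ) : Set ℤ) := by
      intro b hb
      rcases lt_or_ge b c with hbc | hbc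
      · refine ⟨0, fun z hz => ?_⟩
        obtain ⟨n, hn, rfl⟩ := Finset.mem_image.1 (Finset.mem_coe.1 hz)
        rw [sub_zero, Int.natCast_dvd_natCast]
        exact hNfree n hn b hb hbc
      · exact exists_missed_class _ (lt_of_le_of_lt Finset.card_image_le (by omega))
    obtain ⟨t, ht⟩ := exists_translate_free heq _ hadm
    have ht' : ∀ n ∈ N, ∀ b ∈ B, ∀ m : ℕ, n ≡ m [MOD b] → (b : ℤ) ∣ m + t → False := by
      intro n hn b hb m hnm hd
      refine ht n (Finset.mem_image_of_mem _ hn) b hb ?_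
      have h1 : (b : ℤ) ∣ (m : ℤ) - n := hnm.dvd
      have := dvd_sub hd h1
      rwa [show (m : ℤ) + t - (m - n) = n + t by ring] at this
    obtain ⟨s, hs⟩ : ∃ s : ℕ, (s : ℤ) = (-t) % (a : ℤ) :=
      ⟨((-t) % (a : ℤ)).toNat, Int.toNat_of_nonneg (Int.emod_nonneg _ (by omega))⟩
    have hsa : s < a := by
      have := Int.emod_lt_of_pos (-t) (show (0 : ℤ) < a by omega)
      omega
    have hst : (a : ℤ) ∣ s + t := by
      rw [hs]
      have := Int.emod_add_mul_ediv (-t) (a : ℤ)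
      exact ⟨-((-t) / (a : ℤ)), by linarith⟩
    have hsdiv : g * (s / g) + s % g = s := Nat.div_add_mod s g
    have hsa' : s / g < a' := by
      rw [Nat.div_lt_iff_lt_mul hg0, mul_comm, ← ha']
      exact hsa
    have hsg : s % g < g := Nat.mod_lt _ hg0
    obtain ⟨q, hq⟩ : ∃ q, s / g = q := ⟨_, rfl⟩
    rw [hq] at hsdiv hsa'
    by_cases hgs : s % g = 0
    · by_cases hs0 : q = 0
      · have hs00 : s = 0 := by rw [← hsdiv, hgs, hs0]; simp
        rw [hs00] at hst
        have hat : (a : ℤ) ∣ t := by simpa using hst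
        have hgt : (g : ℤ) ∣ t :=
          (Int.natCast_dvd_natCast.2 (Dvd.intro a' ha'.symm)).trans hat
        obtain ⟨u, hu⟩ := hgt
        have hc'0 : (0 : ℤ) < c' := by omega
        obtain ⟨j, hj⟩ : ∃ j : ℕ, (j : ℤ) = (-u) % (c' : ℤ) :=
          ⟨((-u) % (c' : ℤ)).toNat, Int.toNat_of_nonneg (Int.emod_nonneg _ (by omega))⟩
        have hjc : j < c' := by
          have := Int.emod_lt_of_pos (-u) hc'0
          omega
        refine ht' (h j) ?_ c hc _ (hh2 j) ?_
        · exact Finset.mem_union_right _ (Finset.mem_image_of_mem _ (Finset.mem_range.2 hjc))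
        · have h1 := Int.emod_add_mul_ediv (-u) (c' : ℤ)
          rw [← hj] at h1
          refine ⟨-((-u) / (c' : ℤ)), ?_⟩
          rw [hu, hc']
          push_cast
          linear_combination (g : ℤ) * h1
      · refine ht' (h (q - 1)) ?_ a ha _ (hh1 _) ?_
        · exact Finset.mem_union_right _
            (Finset.mem_image_of_mem _ (Finset.mem_range.2 (by omega)))
        · rw [Nat.mod_eq_of_lt (by omega), show 1 + (q - 1) = q by omega]
          rw [hgs, add_zero] at hsdiv
          rwa [hsdiv]
    · have hp : (q, s % g) ∈ Finset.range a' ×ˢ Finset.Ico 1 g := by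
        simp only [Finset.mem_product, Finset.mem_range, Finset.mem_Ico]
        omega
      refine ht' (f (q, s % g)) ?_ a ha _ (hf _ hp).1 ?_
      · exact Finset.mem_union_left _ (Finset.mem_image_of_mem _ hp)
      · simp only [hsdiv]
        exact hst
  intro a ha b hb hab
  by_contra hn
  rcases lt_or_gt_of_ne hab with h | h
  · exact key ⟨b, hb, a, ha, h, hn⟩
  · exact key ⟨a, ha, b, hb, h, fun h' => hn h'.symm⟩

/-- A point of `X_B` which near the origin looks like `W`, and which elsewhere has isolated ones
in every residue class mod `b` other than the class of `c`. -/
lemma exists_probe {B : Set ℕ} (hBpos : ∀ b ∈ B, 2 ≤ b)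
    (hcop : ∀ a ∈ B, ∀ b ∈ B, a ≠ b → Nat.Coprime a b) {ℓ : ℕ} {W : Finset ℤ}
    (hW : IsBAdmissible B W) (hWℓ : ∀ w ∈ W, |w| ≤ ℓ) (hWne : W.Nonempty) {b : ℕ} (hb : b ∈ B)
    {c : ℤ} (hc : ∀ w ∈ W, ¬ ((b : ℤ) ∣ w - c)) :
    ∃ y ∈ XB B, (∀ i : ℤ, |i| ≤ ℓ → (y i = true ↔ i ∈ W)) ∧
      ∀ r : ℤ, ¬ ((b : ℤ) ∣ r - c) →
        ∃ n : ℤ, (b : ℤ) ∣ n - r ∧ ∀ i : ℤ, |i - n| ≤ 2 * ℓ → (y i = true ↔ i = n) := by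
  classical
  obtain ⟨w₀, hw₀⟩ := hWne
  have hb2 := hBpos b hb
  set P : ℕ := ∏ b' ∈ (Finset.range (W.card + b + 1)).filter (fun b' => b' ∈ B ∧ b' ≠ b), b'
  have hPcop : Nat.Coprime P b := Nat.Coprime.prod_left fun b' hb' => by
    rw [Finset.mem_filter] at hb'
    exact hcop b' hb'.2.1 b hb hb'.2.2
  have hP0 : 0 < P := Finset.prod_pos fun b' hb' => by
    rw [Finset.mem_filter] at hb'
    have := hBpos b' hb'.2.1
    omega
  set T : ℕ := P * (b * (4 * ℓ + 1) + 1)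
  have hTcop : Nat.Coprime T b := by
    refine Nat.Coprime.mul_left hPcop ?_
    rw [Nat.coprime_mul_left_add_left]
    exact Nat.coprime_one_left b
  have hTbig : 4 * ℓ + 1 ≤ T := by
    calc 4 * ℓ + 1 ≤ 1 * (b * (4 * ℓ + 1) + 1) := by nlinarith
      _ ≤ T := Nat.mul_le_mul_right _ hP0
  have hTdvd : ∀ b' ∈ B, b' ≤ W.card + b → b' ≠ b → b' ∣ T := fun b' hb' hle hne =>
    (Finset.dvd_prod_of_mem _ (by simp [hb', hne]; omega)).trans (Dvd.intro _ rfl)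
  set Q : Finset ℤ := ((Finset.Icc 1 b).image (fun k : ℕ => w₀ + (T : ℤ) * k)).filter
    (fun n => ¬ ((b : ℤ) ∣ n - c))
  have hQmem : ∀ n ∈ Q, ∃ k : ℕ, 1 ≤ k ∧ n = w₀ + (T : ℤ) * k := by
    intro n hn
    obtain ⟨k, hk, rfl⟩ := Finset.mem_image.1 (Finset.mem_filter.1 hn).1
    exact ⟨k, (Finset.mem_Icc.1 hk).1, rfl⟩
  have hQcard : Q.card ≤ b :=
    (Finset.card_filter_le _ _).trans (Finset.card_image_le.trans (by simp))
  have hQbig : ∀ n ∈ Q, 3 * (ℓ : ℤ) < n := by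
    intro n hn
    obtain ⟨k, hk, rfl⟩ := hQmem n hn
    have h1 := abs_le.1 (hWℓ w₀ hw₀)
    have h2 : (T : ℤ) * 1 ≤ T * k := mul_le_mul_of_nonneg_left (by omega) (by omega)
    omega
  refine ⟨indSeq ((W ∪ Q : Finset ℤ) : Set ℤ), indSeq_mem_XB.2 ?_, ?_, ?_⟩
  · intro b' hb'
    by_cases hbb : b' = b
    · subst hbb
      refine ⟨c, fun n hn => ?_⟩
      rcases Finset.mem_union.1 (Finset.mem_coe.1 hn) with h | h
      · exact hc n h
      · exact (Finset.mem_filter.1 h).2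
    · rcases le_or_gt b' (W.card + b) with hle | hlt
      · obtain ⟨r, hr⟩ := hW b' hb'
        refine ⟨r, fun n hn => ?_⟩
        rcases Finset.mem_union.1 (Finset.mem_coe.1 hn) with h | h
        · exact hr n h
        · obtain ⟨k, -, rfl⟩ := hQmem n h
          intro hd
          refine hr w₀ hw₀ ?_
          have h1 : (b' : ℤ) ∣ (T : ℤ) * k :=
            (Int.natCast_dvd_natCast.2 (hTdvd b' hb' hle hbb)).mul_right _
          have := dvd_sub hd h1
          rwa [show w₀ + (T : ℤ) * k - r - T * k = w₀ - r by ring] at this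
      · refine exists_missed_class _ (lt_of_le_of_lt (Finset.card_union_le _ _) ?_)
        omega
  · intro i hi
    rw [indSeq_eq_true, Finset.mem_coe, Finset.mem_union]
    refine ⟨fun h => h.resolve_right fun h' => ?_, Or.inl⟩
    have := hQbig i h'
    have := (abs_le.1 hi).2
    omega
  · intro r hr
    obtain ⟨k, hk1, hkb, hk⟩ : ∃ k : ℕ, 1 ≤ k ∧ k ≤ b ∧ (b : ℤ) ∣ w₀ + (T : ℤ) * k - r := by
      have hco : IsCoprime (T : ℤ) (b : ℤ) := Nat.isCoprime_iff_coprime.2 hTcop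
      obtain ⟨u, v, huv⟩ := hco
      have hbpos : (0 : ℤ) < b := by omega
      have h0 := Int.emod_nonneg (u * (r - w₀) - 1) hbpos.ne'
      have h1 := Int.emod_lt_of_pos (u * (r - w₀) - 1) hbpos
      have h2 := Int.emod_add_mul_ediv (u * (r - w₀) - 1) (b : ℤ)
      set q := (u * (r - w₀) - 1) / (b : ℤ)
      refine ⟨((u * (r - w₀) - 1) % (b : ℤ) + 1).toNat, by omega, by omega, ?_⟩
      rw [Int.toNat_of_nonneg (by omega)]
      refine ⟨- T * q - v * (r - w₀), ?_⟩
      linear_combination (T : ℤ) * h2 + (r - w₀) * huv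
    have hn : w₀ + (T : ℤ) * k ∈ Q := by
      refine Finset.mem_filter.2 ⟨Finset.mem_image.2
        ⟨k, Finset.mem_Icc.2 ⟨hk1, hkb⟩, rfl⟩, fun hd => hr ?_⟩
      have := dvd_sub hd hk
      rwa [show w₀ + (T : ℤ) * k - c - (w₀ + T * k - r) = r - c by ring] at this
    refine ⟨_, hk, fun i hi => ?_⟩
    rw [indSeq_eq_true, Finset.mem_coe, Finset.mem_union]
    refine ⟨?_, fun h => Or.inr (h ▸ hn)⟩
    have hnb := hQbig _ hn
    have hiab := abs_le.1 hi
    rintro (h | h)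
    · have h1 := abs_le.1 (hWℓ i h)
      have h2 := abs_le.1 (hWℓ w₀ hw₀)
      have h3 : (T : ℤ) * 1 ≤ T * k := mul_le_mul_of_nonneg_left (by omega) (by omega)
      omega
    · obtain ⟨k', hk', rfl⟩ := hQmem i h
      rcases lt_trichotomy k k' with hlt | rfl | hlt
      · have : (T : ℤ) * (k + 1) ≤ T * k' := mul_le_mul_of_nonneg_left (by omega) (by omega)
        rw [mul_add] at this
        omega
      · rfl
      · have : (T : ℤ) * (k' + 1) ≤ T * k := mul_le_mul_of_nonneg_left (by omega) (by omega)
        rw [mul_add] at this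
        omega

/-- A cellular automaton commutes with all powers of the shift. -/
lemma IsCA.map_shiftPow {B : Set ℕ} {τ : (ℤ → Bool) → (ℤ → Bool)} (hτ : IsCA (XB B) τ)
    {x : ℤ → Bool} (hx : x ∈ XB B) (t : ℤ) : τ (shiftPow t x) = shiftPow t (τ x) := by
  have hadd : ∀ (s t : ℤ) (z : ℤ → Bool), shiftPow s (shiftPow t z) = shiftPow (t + s) z := by
    intro s t z
    ext n
    simp only [shiftPow]
    congr 1
    ring
  have hzero : ∀ z : ℤ → Bool, shiftPow 0 z = z := fun z => by
    ext n
    simp [shiftPow]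
  induction t using Int.induction_on with
  | zero => rw [hzero, hzero]
  | succ k ih =>
    rw [← hadd 1 k x, ← hadd 1 k (τ x), ← ih]
    exact hτ.2.2 _ (shiftPow_mem_XB hx _)
  | pred k ih =>
    have h := hτ.2.2 _ (shiftPow_mem_XB hx (-(k : ℤ) - 1))
    rw [shift, hadd, show -(k : ℤ) - 1 + 1 = -k by ring, ih] at h
    have h' := congrArg (shiftPow (-1)) h
    rw [hadd, hadd, show (1 : ℤ) + -1 = 0 by ring, hzero] at h'
    rw [← h', sub_eq_add_neg]

/-- A cellular automaton on a compact `X_B` is a sliding block code. -/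
lemma IsCA.exists_radius {B : Set ℕ} (hcomp : IsCompact (XB B))
    {τ : (ℤ → Bool) → (ℤ → Bool)} (hτ : IsCA (XB B) τ) :
    ∃ ℓ : ℕ, ∀ x ∈ XB B, ∀ y ∈ XB B, ∀ n m : ℤ,
      (∀ i : ℤ, |i| ≤ ℓ → x (n + i) = y (m + i)) → τ x n = τ y m := by
  have hloc : ∃ ℓ : ℕ, ∀ x ∈ XB B, x ∈ XB B → ∀ y ∈ XB B,
      (∀ i : ℤ, |i| ≤ ℓ → x i = y i) → τ x 0 = τ y 0 := by
    refine hcomp.induction_on (p := fun s => ∃ ℓ : ℕ, ∀ x ∈ s, x ∈ XB B → ∀ y ∈ XB B,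
      (∀ i : ℤ, |i| ≤ ℓ → x i = y i) → τ x 0 = τ y 0) ⟨0, by simp⟩ ?_ ?_ ?_
    · rintro s t hst ⟨ℓ, h⟩
      exact ⟨ℓ, fun x hx => h x (hst hx)⟩
    · rintro s t ⟨ℓ, h⟩ ⟨ℓ', h'⟩
      refine ⟨max ℓ ℓ', ?_⟩
      rintro x (hx | hx) hxX y hy hxy
      · exact h x hx hxX y hy fun i hi => hxy i (hi.trans (by simp))
      · exact h' x hx hxX y hy fun i hi => hxy i (hi.trans (by simp))
    · intro x hx
      have hcont : ContinuousWithinAt (fun z => τ z 0) (XB B) x :=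
        (continuous_apply (0 : ℤ)).continuousAt.comp_continuousWithinAt (hτ.2.1 x hx)
      have hev : ∀ᶠ z in nhdsWithin x (XB B), τ z 0 = τ x 0 :=
        hcont.tendsto.eventually (p := fun v => v = τ x 0)
          ((isOpen_discrete {τ x 0}).mem_nhds rfl)
      rw [eventually_nhdsWithin_iff, nhds_pi, Filter.eventually_iff, Filter.mem_pi] at hev
      obtain ⟨I, hI, t, ht, hsub⟩ := hev
      obtain ⟨ℓ, hℓ⟩ : ∃ ℓ : ℕ, ∀ i ∈ I, |i| ≤ (ℓ : ℤ) := by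
        obtain ⟨M, hM⟩ := (hI.image (fun i : ℤ => i.natAbs)).bddAbove
        refine ⟨M, fun i hi => ?_⟩
        have hi' : i.natAbs ≤ M := hM (mem_image_of_mem _ hi)
        rw [Int.abs_eq_natAbs]
        exact_mod_cast hi'
      have hcyl : ∀ z ∈ XB B, (∀ i : ℤ, |i| ≤ ℓ → x i = z i) → τ z 0 = τ x 0 := by
        intro z hz hxz
        refine hsub (fun i hi => ?_) hz
        rw [← hxz i (hℓ i hi)]
        exact mem_of_mem_nhds (ht i)
      refine ⟨{z | ∀ i : ℤ, |i| ≤ ℓ → x i = z i}, mem_nhdsWithin_of_mem_nhds ?_, ℓ, ?_⟩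
      · have hfin : {i : ℤ | |i| ≤ ℓ}.Finite := by
          refine (Set.finite_Icc (-(ℓ : ℤ)) ℓ).subset fun i hi => ?_
          exact abs_le.1 hi
        have hset : {z : ℤ → Bool | ∀ i : ℤ, |i| ≤ ℓ → x i = z i} =
            {i : ℤ | |i| ≤ ℓ}.pi (fun i => {x i}) := by
          ext z
          simp [Set.mem_pi, eq_comm]
        rw [hset]
        exact (isOpen_set_pi hfin (fun _ _ => isOpen_discrete _)).mem_nhds (by simp [Set.mem_pi])
      · intro z hz hzX y hy hzy
        rw [hcyl z hzX hz, hcyl y hy fun i hi => (hz i hi).trans (hzy i hi)]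
  obtain ⟨ℓ, hℓ⟩ := hloc
  refine ⟨ℓ, fun x hx y hy n m h => ?_⟩
  have := hℓ _ (shiftPow_mem_XB hx n) (shiftPow_mem_XB hx n) _ (shiftPow_mem_XB hy m)
    (fun i hi => by simpa [shiftPow, add_comm] using h i hi)
  rw [hτ.map_shiftPow hx, hτ.map_shiftPow hy] at this
  simpa [shiftPow] using this

lemma isBAdmissible_singleton {B : Set ℕ} (hBpos : ∀ b ∈ B, 2 ≤ b) (n : ℤ) :
    IsBAdmissible B {n} := fun b hb => by
  have := exists_missed_class {n} (b := b) (by have := hBpos b hb; simp; omega)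
  simpa using this

/-- A pre-injective cellular automaton on `X_B`, with `B` infinite and pairwise coprime, is a
power of the shift. -/
lemma IsCA.exists_eq_translate {B : Set ℕ} (hBinf : B.Infinite) (hBpos : ∀ b ∈ B, 2 ≤ b)
    (hcop : ∀ a ∈ B, ∀ b ∈ B, a ≠ b → Nat.Coprime a b) (hcomp : IsCompact (XB B))
    {τ : (ℤ → Bool) → (ℤ → Bool)} (hτ : IsCA (XB B) τ) (hpre : PreInjective (XB B) τ) :
    ∃ a : ℤ, ∀ x ∈ XB B, ∀ n, τ x (n + a) = x n := by
  classical
  obtain ⟨ℓ, hℓ⟩ := hτ.exists_radius hcomp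
  have h0X : indSeq ∅ ∈ XB B := indSeq_mem_XB.2 fun b _ => ⟨0, fun a ha => ha.elim⟩
  have huX : indSeq {0} ∈ XB B := indSeq_mem_XB.2 (isBAdmissible_singleton hBpos 0)
  have hτ0 : ∀ n, τ (indSeq ∅) n = false := by
    intro n
    by_contra hn
    obtain ⟨b, hb⟩ := hBinf.nonempty
    obtain ⟨r, hr⟩ := hτ.1 h0X b hb
    refine hr r ?_ (by simp)
    rw [supp, mem_ofPred_eq, hℓ _ h0X _ h0X r n (fun i _ => by simp [indSeq])]
    simpa using hn
  have huℓ : ∀ n, τ (indSeq {0}) n = true → |n| ≤ ℓ := by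
    intro n hn
    by_contra hlt
    rw [hℓ _ huX _ h0X n n, hτ0] at hn
    · exact absurd hn (by simp)
    · intro i hi
      have : n + i ≠ 0 := fun h => hlt (by rwa [show n = -i by omega, abs_neg])
      simp [indSeq, this]
  obtain ⟨a, ha⟩ : ∃ a, τ (indSeq {0}) a = true := by
    by_contra hne
    push Not at hne
    have heq : indSeq {0} = indSeq ∅ := by
      refine hpre _ huX _ h0X ?_ ?_
      · ext n
        rw [hτ0, Bool.eq_false_iff.2 (hne n)]
      · refine (Set.finite_singleton (0 : ℤ)).subset fun n hn => ?_
        by_contra h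
        exact hn (by simpa [indSeq] using h)
    simpa [indSeq] using congrFun heq 0
  have haℓ := huℓ a ha
  have hisol : ∀ y ∈ XB B, ∀ (n e : ℤ) (ℓ' : ℕ), ℓ ≤ ℓ' → |e| ≤ ℓ →
      (∀ i : ℤ, |i - n| ≤ 2 * ℓ' → (y i = true ↔ i = n)) →
      τ y (n + e) = τ (indSeq {0}) e := by
    intro y hy n e ℓ' hℓ' he hiso
    refine hℓ _ hy _ huX _ _ fun i hi => ?_
    rw [Bool.eq_iff_iff, indSeq_eq_true, hiso]
    · rw [mem_singleton_iff]
      omega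
    · rw [abs_le] at *
      omega
  have huniq : ∀ a', τ (indSeq {0}) a' = true → a' = a := by
    intro a' ha'
    by_contra hne
    obtain ⟨b, hb, hbig⟩ := hBinf.exists_gt (a' - a).natAbs
    have hb2 := hBpos b hb
    obtain ⟨y, hy, -, hyiso⟩ := exists_probe hBpos hcop (ℓ := ℓ) (W := {0}) (c := 1)
      (by simpa using isBAdmissible_singleton hBpos 0) (by simp) (by simp) hb (by
        simp only [Finset.mem_singleton, forall_eq, zero_sub, dvd_neg]
        intro h
        have := Int.le_of_dvd one_pos h
        omega)
    obtain ⟨r, hr⟩ := hτ.1 hy b hb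
    have hall : ∀ e, τ (indSeq {0}) e = true → (b : ℤ) ∣ r - e - 1 := by
      intro e he
      by_contra hnd
      obtain ⟨n, hn, hiso⟩ := hyiso (r - e) hnd
      refine hr (n + e) ?_ (by rwa [show n + e - r = n - (r - e) by ring])
      rw [supp, mem_ofPred_eq, hisol y hy n e ℓ le_rfl (huℓ e he) hiso, he]
    have hd := dvd_sub (hall a ha) (hall a' ha')
    rw [show r - a - 1 - (r - a' - 1) = a' - a by ring] at hd
    exact hne (by
      have := Int.eq_zero_of_dvd_of_natAbs_lt_natAbs hd (by simpa using hbig)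
      omega)
  have hle0 : ∀ x ∈ XB B, τ x a = true → x 0 = true := by
    intro x hx hxa
    by_contra hx0
    set W : Finset ℤ := (Finset.Icc (-(2 * ℓ : ℤ)) (2 * ℓ)).filter (fun i => x i = true) with hWdef
    have hWadm : IsBAdmissible B W :=
      IsBAdmissible.mono hx fun i hi => (Finset.mem_filter.1 (Finset.mem_coe.1 hi)).2
    have hWℓ : ∀ w ∈ W, |w| ≤ ((2 * ℓ : ℕ) : ℤ) := by
      intro w hw
      have := Finset.mem_Icc.1 (Finset.mem_filter.1 hw).1
      rw [abs_le]
      push_cast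
      omega
    have hWx : ∀ i : ℤ, |i| ≤ ((2 * ℓ : ℕ) : ℤ) → (x i = true ↔ i ∈ W) := by
      intro i hi
      rw [abs_le] at hi
      push_cast at hi
      simp only [hWdef, Finset.mem_filter, Finset.mem_Icc]
      exact ⟨fun h => ⟨⟨by omega, by omega⟩, h⟩, fun h => h.2⟩
    have hwin : ∀ z ∈ XB B, (∀ i : ℤ, |i| ≤ ((2 * ℓ : ℕ) : ℤ) → (z i = true ↔ i ∈ W)) →
        τ z a = true := by
      intro z hz hzW
      rw [← hxa]
      refine hℓ _ hz _ hx _ _ fun i hi => ?_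
      have : |a + i| ≤ ((2 * ℓ : ℕ) : ℤ) := by
        rw [abs_le] at *
        push_cast
        omega
      rw [Bool.eq_iff_iff, hzW _ this, hWx _ this]
    have hWne : W.Nonempty := by
      by_contra hne
      rw [Finset.not_nonempty_iff_eq_empty] at hne
      have := hwin _ h0X fun i _ => by simp [hne, indSeq]
      rw [hτ0] at this
      exact absurd this (by simp)
    obtain ⟨b, hb, hbig⟩ := hBinf.exists_gt (2 * ℓ)
    obtain ⟨y, hy, hyW, hyiso⟩ := exists_probe hBpos hcop hWadm hWℓ hWne hb (c := 0) (by
      intro w hw hd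
      rw [sub_zero] at hd
      have h1 := hWℓ w hw
      have := Int.eq_zero_of_dvd_of_natAbs_lt_natAbs hd (by
        rw [abs_le] at h1
        omega)
      rw [this] at hw
      exact hx0 (Finset.mem_filter.1 hw).2)
    obtain ⟨r, hr⟩ := hτ.1 hy b hb
    by_cases hra : (b : ℤ) ∣ r - a - 0
    · refine hr a (hwin y hy hyW) ?_
      rw [← dvd_neg]
      simpa using hra
    · obtain ⟨n, hn, hiso⟩ := hyiso _ hra
      refine hr (n + a) ?_ (by rwa [show n + a - r = n - (r - a) by ring])
      rw [supp, mem_ofPred_eq, hisol y hy n a (2 * ℓ) (by omega) haℓ hiso, ha]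
  have hle : ∀ x ∈ XB B, ∀ n, τ x (n + a) = true → x n = true := by
    intro x hx n hn
    have := hle0 _ (shiftPow_mem_XB hx n) (by
      rw [hτ.map_shiftPow hx]
      simpa [shiftPow, add_comm] using hn)
    simpa [shiftPow] using this
  have hfin : ∀ F : Finset ℤ, IsBAdmissible B F →
      ∀ n, τ (indSeq F) (n + a) = indSeq (F : Set ℤ) n := by
    intro F
    induction F using Finset.strongInduction with
    | H F ih =>
      intro hF
      have hFX := indSeq_mem_XB.2 hF
      set G : Finset ℤ := F.filter (fun n => τ (indSeq F) (n + a) = true) with hG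
      have hGF : G ⊆ F := Finset.filter_subset _ _
      have hGmem : ∀ n, n ∈ G ↔ τ (indSeq F) (n + a) = true := by
        intro n
        rw [hG, Finset.mem_filter, and_iff_right_iff_imp]
        exact fun h => indSeq_eq_true.1 (hle _ hFX n h)
      have hGe : ∀ n, τ (indSeq F) (n + a) = indSeq (G : Set ℤ) n := by
        intro n
        rw [Bool.eq_iff_iff, indSeq_eq_true, Finset.mem_coe, hGmem]
      rcases hGF.eq_or_ssubset with h | h
      · rw [h] at hGe
        exact hGe
      · exfalso
        have hGadm : IsBAdmissible B G := hF.mono (Finset.coe_subset.2 hGF)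
        have hGG := ih G h hGadm
        have heq : indSeq (G : Set ℤ) = indSeq F := by
          refine hpre _ (indSeq_mem_XB.2 hGadm) _ hFX ?_ ?_
          · ext m
            have h1 := hGG (m - a)
            rw [← hGe, sub_add_cancel] at h1
            rw [h1]
          · refine F.finite_toSet.subset fun n hn => ?_
            by_contra hnF
            refine hn ?_
            have hnG : n ∉ G := fun h' => hnF (hGF h')
            simp only [Finset.mem_coe] at hnF
            simp [indSeq, hnF, hnG]
        refine h.2 fun n hn => ?_
        have := congrFun heq n
        rw [indSeq_eq_true.2 (Finset.mem_coe.2 hn)] at this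
        exact indSeq_eq_true.1 this
  refine ⟨a, fun x hx n => ?_⟩
  set F : Finset ℤ := (Finset.Icc (n - 2 * ℓ) (n + 2 * ℓ)).filter (fun i => x i = true) with hFdef
  have hF : IsBAdmissible B F :=
    IsBAdmissible.mono hx fun i hi => (Finset.mem_filter.1 (Finset.mem_coe.1 hi)).2
  have hFx : ∀ i, |i - n| ≤ 2 * ℓ → x i = indSeq (F : Set ℤ) i := by
    intro i hi
    rw [abs_le] at hi
    rw [Bool.eq_iff_iff, indSeq_eq_true, Finset.mem_coe, hFdef, Finset.mem_filter, Finset.mem_Icc]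
    exact ⟨fun h => ⟨⟨by omega, by omega⟩, h⟩, fun h => h.2⟩
  rw [hFx n (by simp), ← hfin F hF n]
  refine hℓ _ hx _ (indSeq_mem_XB.2 hF) _ _ fun i hi => hFx _ ?_
  rw [abs_le] at *
  omega

/-- if `B` is primitive, infinite, `1 ∉ B` and `X_η = X_B`, then the Myhill
property holds: every pre-injective CA on `(X_η, S)` is surjective. -/
theorem myhill_of_eq_admissible (B : Set ℕ) (hBinf : B.Infinite)
    (hBpos : ∀ b ∈ B, 2 ≤ b) (hBprim : Primitive B)
    (heq : Xeta B = XB B)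
    (τ : (ℤ → Bool) → (ℤ → Bool)) (hτ : IsCA (Xeta B) τ)
    (hpre : PreInjective (Xeta B) τ) :
    Set.SurjOn τ (Xeta B) (Xeta B) := by
  have hcop := coprime_of_eq_admissible hBpos hBprim heq
  have hcomp : IsCompact (XB B) := heq ▸ isClosed_closure.isCompact
  rw [heq] at hτ hpre ⊢
  obtain ⟨a, ha⟩ := hτ.exists_eq_translate hBinf hBpos hcop hcomp hpre
  intro y hy
  refine ⟨shiftPow a y, shiftPow_mem_XB hy a, ?_⟩
  ext n
  have := ha _ (shiftPow_mem_XB hy a) (n - a)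
  simpa [shiftPow] using this
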